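/- In the critical case, with v(t;x) := (Φ(t;x) − P_{10}(t) − P_{11}(t)·x)/x, the integral J₁(t) := b·∫_0^1 v(t;x)/x dx converges for every t > 0 and satisfies J₁(t) = O(ln t / t²) as t → ∞. -/

import Mathlib

open scoped Topology

lemma aux_pk (u : ℝ) (hu0 : 0 ≤ u) (hu1 : u ≤ 1) (k : ℕ) :
    (1 - u) ^ 2 ≤ u ^ (k + 2) - 1 - ((k + 2 : ℕ) : ℝ) * (u - 1) ∧
    u ^ (k + 2) - 1 - ((k + 2 : ℕ) : ℝ) * (u - 1) ≤
      ((k + 2 : ℕ) : ℝ) * (((k + 2 : ℕ) : ℝ) - 1) * (1 - u) ^ 2 := by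
  induction k with
  | zero =>
    constructor
    · norm_num; nlinarith
    · norm_num; nlinarith [sq_nonneg (1 - u)]
  | succ k ih =>
    obtain ⟨h1, h2⟩ := ih
    have e : u ^ (k + 1 + 2) - 1 - ((k + 1 + 2 : ℕ) : ℝ) * (u - 1) =
        u * (u ^ (k + 2) - 1 - ((k + 2 : ℕ) : ℝ) * (u - 1)) +
          ((k + 2 : ℕ) : ℝ) * (1 - u) ^ 2 := by
      push_cast; ring
    rw [e]
    set p := u ^ (k + 2) - 1 - ((k + 2 : ℕ) : ℝ) * (u - 1) with hp
    have hs : 0 ≤ (1 - u) ^ 2 := sq_nonneg _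
    have hk : (0 : ℝ) ≤ k := Nat.cast_nonneg k
    have hp0 : 0 ≤ p := hs.trans h1
    have hup : 0 ≤ u * p := mul_nonneg hu0 hp0
    have hup1 : u * p ≤ p := by nlinarith
    have hks : 0 ≤ (k : ℝ) * (1 - u) ^ 2 := mul_nonneg hk hs
    push_cast at *
    constructor
    · nlinarith
    · nlinarith

lemma aux_f (a : ℕ → ℝ) (f : ℝ → ℝ)
    (ha : ∀ k : ℕ, k ≠ 1 → 0 ≤ a k)
    (ha1 : HasSum (fun k : ℕ => if k = 1 then (0:ℝ) else a k) (-(a 1)))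
    (hf : ∀ x ∈ Set.Icc (0:ℝ) 1, HasSum (fun k : ℕ => a k * x ^ k) (f x))
    (b : ℝ)
    (hcrit : HasSum (fun k : ℕ => (k : ℝ) * a k) 0)
    (hb : HasSum (fun k : ℕ => (k : ℝ) * ((k : ℝ) - 1) * a k) b)
    (u : ℝ) (hu : u ∈ Set.Icc (0:ℝ) 1) :
    (-(a 1) - a 0) * (1 - u) ^ 2 ≤ f u ∧ f u ≤ b * (1 - u) ^ 2 := by
  have hA : HasSum (fun k : ℕ => a k) 0 := by
    have h := ha1.add (hasSum_ite_eq 1 (a 1))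
    rw [neg_add_cancel] at h
    refine h.congr_fun ?_
    intro k
    by_cases hk : k = 1
    · simp [hk]
    · simp [hk]
  have hF : HasSum (fun k : ℕ => a k * (u ^ k - 1 - (k : ℝ) * (u - 1))) (f u) := by
    have h := ((hf u hu).sub hA).sub (hcrit.mul_right (u - 1))
    simp only [sub_zero, zero_mul] at h
    refine h.congr_fun ?_
    intro k
    ring
  have hL : HasSum (fun k : ℕ => ((if k = 1 then (0:ℝ) else a k) - (if k = 0 then a 0 else 0)) * (1 - u) ^ 2)
      ((-(a 1) - a 0) * (1 - u) ^ 2) :=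
    (ha1.sub (hasSum_ite_eq 0 (a 0))).mul_right _
  constructor
  · refine hasSum_le ?_ hL hF
    intro k
    match k with
    | 0 => simp
    | 1 => simp
    | k + 2 =>
      have h := (aux_pk u hu.1 hu.2 k).1
      have hak := ha (k + 2) (by omega)
      simpa using mul_le_mul_of_nonneg_left h hak
  · refine hasSum_le ?_ hF (hb.mul_right _)
    intro k
    match k with
    | 0 => simp
    | 1 => simp
    | k + 2 =>
      have h := (aux_pk u hu.1 hu.2 k).2
      have hak := ha (k + 2) (by omega)
      calc _ ≤ _ := mul_le_mul_of_nonneg_left h hak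
        _ = _ := by ring

lemma aux_lip (a : ℕ → ℝ) (f : ℝ → ℝ)
    (hf : ∀ x ∈ Set.Icc (0:ℝ) 1, HasSum (fun k : ℕ => a k * x ^ k) (f x))
    (hcrit : HasSum (fun k : ℕ => (k : ℝ) * a k) 0) :
    ∃ K : NNReal, LipschitzOnWith K f (Set.Icc 0 1) := by
  have hs : Summable (fun k : ℕ => |(k : ℝ) * a k|) := hcrit.summable.abs
  refine ⟨(∑' k : ℕ, |(k : ℝ) * a k|).toNNReal, ?_⟩
  have hnn : 0 ≤ ∑' k : ℕ, |(k : ℝ) * a k| := tsum_nonneg fun _ => abs_nonneg _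
  refine LipschitzOnWith.of_dist_le_mul ?_
  intro x hx y hy
  rw [Real.coe_toNNReal _ hnn, Real.dist_eq, Real.dist_eq]
  have h1 := (hf x hx).sub (hf y hy)
  have h2 := hs.hasSum.mul_right (|x - y|)
  have key : ∀ k : ℕ, |a k * x ^ k - a k * y ^ k| ≤ |(k : ℝ) * a k| * |x - y| := by
    intro k
    rw [← mul_sub, abs_mul, abs_mul, Nat.abs_cast]
    have h := abs_pow_sub_pow_le x y k
    have hm : (max |x| |y|) ^ (k - 1) ≤ 1 := by
      apply pow_le_one₀
      · positivity
      · rw [abs_of_nonneg hx.1, abs_of_nonneg hy.1]; exact max_le hx.2 hy.2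
    have h' : |x ^ k - y ^ k| ≤ |x - y| * k := by
      refine h.trans ?_
      have : 0 ≤ |x - y| * (k : ℝ) := by positivity
      nlinarith
    calc |a k| * |x ^ k - y ^ k| ≤ |a k| * (|x - y| * k) :=
          mul_le_mul_of_nonneg_left h' (abs_nonneg _)
      _ = _ := by ring
  rw [abs_le]
  constructor
  · have := hasSum_le (fun k => (abs_le.1 (key k)).1) h2.neg h1
    exact this
  · exact hasSum_le (fun k => (abs_le.1 (key k)).2) h1 h2

/-- Lower bound for solutions of `z' = f z`, starting from `0`. -/
lemma aux_z (f z : ℝ → ℝ) (b c : ℝ) (hb : 0 ≤ b)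
    (hf : ∀ u ∈ Set.Icc (0:ℝ) 1, c * (1 - u) ^ 2 ≤ f u ∧ f u ≤ b * (1 - u) ^ 2)
    (hz : ∀ t, 0 ≤ t → z t ∈ Set.Icc (0:ℝ) 1) (hz0 : z 0 = 0)
    (hd : ∀ t, 0 ≤ t → HasDerivAt z (f (z t)) t) (t : ℝ) (ht : 0 ≤ t) :
    (1 - z t) * (1 + c * t) ≤ 1 := by
  have hpos : ∀ t, 0 ≤ t → 0 < 1 - z t := by
    intro t ht
    have hD : ∀ s, 0 ≤ s → HasDerivAt (fun s => (1 - z s) * Real.exp (b * s))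
        ((0 - f (z s)) * Real.exp (b * s) + (1 - z s) * (Real.exp (b * s) * (b * 1))) s := by
      intro s hs
      exact ((hasDerivAt_const s (1:ℝ)).sub (hd s hs)).mul
        (((hasDerivAt_id s).const_mul b).exp)
    have hm : MonotoneOn (fun s => (1 - z s) * Real.exp (b * s)) (Set.Ici 0) := by
      refine monotoneOn_of_deriv_nonneg (convex_Ici 0) ?_ ?_ ?_
      · exact fun s hs => (hD s hs).continuousAt.continuousWithinAt
      · intro s hs
        rw [interior_Ici] at hs
        exact (hD s (le_of_lt hs)).differentiableAt.differentiableWithinAt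
      · intro s hs
        rw [interior_Ici] at hs
        have hs' : 0 ≤ s := le_of_lt hs
        rw [(hD s hs').deriv]
        have h1 := (hf _ (hz s hs')).2
        have h2 := hz s hs'
        have h3 : b * (1 - z s) ^ 2 ≤ b * (1 - z s) := by
          apply mul_le_mul_of_nonneg_left _ hb
          nlinarith [h2.1, h2.2]
        have : 0 ≤ Real.exp (b * s) * (b * (1 - z s) - f (z s)) :=
          mul_nonneg (Real.exp_pos _).le (by linarith)
        linarith
    have h := hm (Set.mem_Ici.2 le_rfl) (Set.mem_Ici.2 ht) ht
    simp only [hz0, mul_zero, Real.exp_zero] at h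
    by_contra hc
    have : (1 - z t) * Real.exp (b * t) ≤ 0 :=
      mul_nonpos_of_nonpos_of_nonneg (not_lt.1 hc) (Real.exp_pos _).le
    linarith
  have hD : ∀ s, 0 ≤ s → HasDerivAt (fun s => (1 - z s)⁻¹ - c * s)
      (-(0 - f (z s)) / (1 - z s) ^ 2 - c * 1) s := by
    intro s hs
    exact (((hasDerivAt_const s (1:ℝ)).sub (hd s hs)).inv (hpos s hs).ne').sub
      ((hasDerivAt_id s).const_mul c)
  have hm : MonotoneOn (fun s => (1 - z s)⁻¹ - c * s) (Set.Ici 0) := by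
    refine monotoneOn_of_deriv_nonneg (convex_Ici 0) ?_ ?_ ?_
    · exact fun s hs => (hD s hs).continuousAt.continuousWithinAt
    · intro s hs
      rw [interior_Ici] at hs
      exact (hD s (le_of_lt hs)).differentiableAt.differentiableWithinAt
    · intro s hs
      rw [interior_Ici] at hs
      have hs' : 0 ≤ s := le_of_lt hs
      rw [(hD s hs').deriv]
      have h1 := (hf _ (hz s hs')).1
      have h2 : 0 < (1 - z s) ^ 2 := pow_pos (hpos s hs') 2
      have : c ≤ f (z s) / (1 - z s) ^ 2 := by rwa [le_div_iff₀ h2]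
      simpa using this
  have h := hm (Set.mem_Ici.2 le_rfl) (Set.mem_Ici.2 ht) ht
  simp only [hz0, mul_zero, sub_zero, inv_one] at h
  have hp := hpos t ht
  have h' : 1 + c * t ≤ (1 - z t)⁻¹ := by linarith
  calc (1 - z t) * (1 + c * t) ≤ (1 - z t) * (1 - z t)⁻¹ :=
        mul_le_mul_of_nonneg_left h' hp.le
    _ = 1 := mul_inv_cancel₀ hp.ne'

/-- Increment bound via time shift. -/
lemma aux_inc (f y z : ℝ → ℝ) (b c x : ℝ) (hb : 0 ≤ b) (hc : 0 < c)
    (K : NNReal) (hK : LipschitzOnWith K f (Set.Icc 0 1))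
    (hf : ∀ u ∈ Set.Icc (0:ℝ) 1, c * (1 - u) ^ 2 ≤ f u ∧ f u ≤ b * (1 - u) ^ 2)
    (hz : ∀ t, 0 ≤ t → z t ∈ Set.Icc (0:ℝ) 1) (hz0 : z 0 = 0)
    (hd : ∀ t, 0 ≤ t → HasDerivAt z (f (z t)) t)
    (hx0 : 0 ≤ x) (hx1 : x < 1)
    (hy : ∀ t, 0 ≤ t → y t ∈ Set.Icc (0:ℝ) 1) (hy0 : y 0 = x)
    (hyd : ∀ t, 0 ≤ t → HasDerivAt y (f (y t)) t) (t : ℝ) (ht : 0 < t) :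
    (y t - z t) * (1 - x) ≤ b / c ^ 3 / t ^ 2 := by
  have hZ := aux_z f z b c hb hf hz hz0 hd
  have hx' : 0 < 1 - x := by linarith
  set T := 1 / (c * (1 - x)) with hT
  have hTpos : 0 < T := by positivity
  have hcT : (1 - x) * (c * T) = 1 := by rw [hT]; field_simp
  have hzT : x ≤ z T := by
    have h := hZ T hTpos.le
    have h2 := hz T hTpos.le
    by_contra hlt
    have h3 : 1 - x < 1 - z T := by linarith
    have h4 : 0 < 1 + c * T := by positivity
    have := mul_lt_mul_of_pos_right h3 h4
    nlinarith
  have hcont : ContinuousOn z (Set.Icc 0 T) :=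
    fun s hs => (hd s hs.1).continuousAt.continuousWithinAt
  obtain ⟨s, hs, hzs⟩ := intermediate_value_Icc hTpos.le hcont
    (show x ∈ Set.Icc (z 0) (z T) from ⟨by rw [hz0]; exact hx0, hzT⟩)
  have hsh : ∀ r, 0 ≤ r → HasDerivAt (fun r => z (r + s)) (f (z (r + s))) r := by
    intro r hr
    exact HasDerivAt.comp_add_const r s (hd (r + s) (add_nonneg hr hs.1))
  have hEq : Set.EqOn y (fun r => z (r + s)) (Set.Icc 0 t) := by
    refine ODE_solution_unique_of_mem_Icc_right (v := fun _ => f) (s := fun _ => Set.Icc 0 1)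
      (K := K) (fun _ _ => hK) ?_ ?_ ?_ ?_ ?_ ?_ ?_
    · exact fun r hr => (hyd r hr.1).continuousAt.continuousWithinAt
    · exact fun r hr => (hyd r hr.1).hasDerivWithinAt
    · exact fun r hr => hy r hr.1
    · exact fun r hr => (hsh r hr.1).continuousAt.continuousWithinAt
    · exact fun r hr => (hsh r hr.1).hasDerivWithinAt
    · exact fun r hr => hz _ (add_nonneg hr.1 hs.1)
    · simp [hy0, hzs]
  have hyt : y t = z (t + s) := hEq ⟨ht.le, le_rfl⟩
  have hbound : ∀ r, t ≤ r → f (z r) ≤ b / (c * t) ^ 2 := by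
    intro r hr
    have hr0 : 0 ≤ r := ht.le.trans hr
    have h1 := (hf _ (hz r hr0)).2
    have h2 := hZ r hr0
    have h3 : 0 ≤ 1 - z r := by linarith [(hz r hr0).2]
    have hct : 0 < c * t := by positivity
    have h4 : (1 - z r) ≤ 1 / (c * t) := by
      rw [le_div_iff₀ hct]
      refine le_trans ?_ h2
      apply mul_le_mul_of_nonneg_left _ h3
      have := mul_le_mul_of_nonneg_left hr hc.le
      linarith
    calc f (z r) ≤ b * (1 - z r) ^ 2 := h1
      _ ≤ b * (1 / (c * t)) ^ 2 := by gcongr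
      _ = _ := by ring
  have hinc : z (t + s) - z t ≤ b / (c * t) ^ 2 * ((t + s) - t) := by
    refine (convex_Ici t).image_sub_le_mul_sub_of_deriv_le
      (f := z) ?_ ?_ ?_ t (Set.mem_Ici.2 le_rfl) (t + s) (Set.mem_Ici.2 (by linarith [hs.1]))
      (by linarith [hs.1])
    · exact fun r hr => (hd r (ht.le.trans hr)).continuousAt.continuousWithinAt
    · intro r hr
      rw [interior_Ici] at hr
      exact (hd r (ht.le.trans (le_of_lt hr))).differentiableAt.differentiableWithinAt
    · intro r hr
      rw [interior_Ici] at hr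
      rw [(hd r (ht.le.trans (le_of_lt hr))).deriv]
      exact hbound r (le_of_lt hr)
  rw [hyt]
  calc (z (t + s) - z t) * (1 - x) ≤ (b / (c * t) ^ 2 * T) * (1 - x) := by
        apply mul_le_mul_of_nonneg_right _ hx'.le
        refine hinc.trans ?_
        apply mul_le_mul_of_nonneg_left _ (by positivity)
        linarith [hs.2]
    _ = _ := by rw [hT]; field_simp

/-- The integrand as a power series. -/
lemma aux_F (p : ℕ → ℝ) (φ x : ℝ) (hx : 0 < x)
    (h : HasSum (fun j : ℕ => p j * x ^ j) φ) :
    HasSum (fun j : ℕ => p (j + 2) * x ^ j) ((φ - p 0 - p 1 * x) / x / x) := by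
  have h2 := (hasSum_nat_add_iff' 2).2 h
  have h3 := (h2.div_const x).div_const x
  simp only [Finset.sum_range_succ, Finset.sum_range_zero, pow_zero, pow_one, zero_add,
    mul_one] at h3
  rw [sub_sub]
  refine h3.congr_fun ?_
  intro j
  field_simp
  ring

lemma aux_int (F : ℝ → ℝ) (M t : ℝ) (hM : 0 ≤ M) (ht : 2 ≤ t)
    (hF : IntervalIntegrable F MeasureTheory.volume 0 1)
    (h0 : ∀ x ∈ Set.Ioo (0:ℝ) 1, 0 ≤ F x)
    (h1 : ∀ x ∈ Set.Ioo (0:ℝ) 1, F x ≤ 1)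
    (h2 : ∀ x ∈ Set.Ioo (0:ℝ) 1, F x * (1 - x) ≤ M / t ^ 2) :
    |∫ x in (0:ℝ)..1, F x| ≤ (M + 1) * 3 * (Real.log t / t ^ 2) := by
  have ht0 : 0 < t := by linarith
  set ε := 1 / t ^ 2 with hε
  have hεp : 0 < ε := by positivity
  have hnn : 0 ≤ ∫ x in (0:ℝ)..1, F x := by
    rw [intervalIntegral.integral_of_le zero_le_one, MeasureTheory.integral_Ioc_eq_integral_Ioo]
    exact MeasureTheory.setIntegral_nonneg measurableSet_Ioo h0
  rw [abs_of_nonneg hnn]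
  have hint : ∫ x in (0:ℝ)..1, (M + 1) * ε * (1 + ε - x)⁻¹ = (M + 1) * ε * Real.log (1 + t ^ 2) := by
    rw [intervalIntegral.integral_const_mul, intervalIntegral.integral_comp_sub_left (fun x => x⁻¹),
      integral_inv_of_pos (by linarith) (by linarith)]
    congr 2
    rw [hε]; field_simp
    ring
  have hii : IntervalIntegrable (fun x => (M + 1) * ε * (1 + ε - x)⁻¹) MeasureTheory.volume 0 1 := by
    apply ContinuousOn.intervalIntegrable
    apply ContinuousOn.mul continuousOn_const
    apply ContinuousOn.inv₀
    · fun_prop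
    · intro x hx
      rw [Set.uIcc_of_le zero_le_one] at hx
      have := hx.2
      exact ne_of_gt (by linarith)
  have hle : ∫ x in (0:ℝ)..1, F x ≤ ∫ x in (0:ℝ)..1, (M + 1) * ε * (1 + ε - x)⁻¹ := by
    apply intervalIntegral.integral_mono_on_of_le_Ioo zero_le_one hF hii
    intro x hx
    have hp : 0 < 1 + ε - x := by linarith [hx.2]
    rw [← div_eq_mul_inv, le_div_iff₀ hp]
    have e1 := h1 x hx
    have e2 := h2 x hx
    have e3 : M / t ^ 2 = M * ε := by rw [hε]; ring
    rw [e3] at e2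
    nlinarith
  rw [hint] at hle
  refine hle.trans ?_
  have hlog : Real.log (1 + t ^ 2) ≤ 3 * Real.log t := by
    have : (3 : ℝ) * Real.log t = Real.log (t ^ 3) := by rw [Real.log_pow]; norm_num
    rw [this]
    apply Real.log_le_log (by positivity)
    nlinarith [sq_nonneg t, mul_nonneg (sq_nonneg t) (sub_nonneg.2 ht)]
  calc (M + 1) * ε * Real.log (1 + t ^ 2) ≤ (M + 1) * ε * (3 * Real.log t) := by gcongr
    _ = _ := by rw [hε]; ring



theorem stmt_12
    (a : ℕ → ℝ) (f : ℝ → ℝ) (P : ℝ → ℕ → ℝ) (Φ : ℝ → ℝ → ℝ)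
    (ha : ∀ k : ℕ, k ≠ 1 → 0 ≤ a k)
    (ha0 : 0 < a 0)
    (ha1 : HasSum (fun k : ℕ => if k = 1 then (0:ℝ) else a k) (-(a 1)))
    (ha01 : a 0 < -(a 1))
    (hf : ∀ x ∈ Set.Icc (0:ℝ) 1, HasSum (fun k : ℕ => a k * x ^ k) (f x))
    (hPnn : ∀ t : ℝ, 0 ≤ t → ∀ j : ℕ, 0 ≤ P t j)
    (hPsum : ∀ t : ℝ, 0 ≤ t → HasSum (fun j : ℕ => P t j) 1)
    (hΦ : ∀ t : ℝ, 0 ≤ t → ∀ x ∈ Set.Icc (0:ℝ) 1, HasSum (fun j : ℕ => P t j * x ^ j) (Φ t x))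
    (hΦ0 : ∀ x ∈ Set.Icc (0:ℝ) 1, Φ 0 x = x)
    (hKol : ∀ x ∈ Set.Icc (0:ℝ) 1, ∀ t : ℝ, 0 ≤ t → HasDerivAt (fun s => Φ s x) (f (Φ t x)) t)
    (b : ℝ)
    (hcrit : HasSum (fun k : ℕ => (k : ℝ) * a k) 0)
    (hb : HasSum (fun k : ℕ => (k : ℝ) * ((k : ℝ) - 1) * a k) b)
    :
    (∀ t : ℝ, 0 < t →
        IntervalIntegrable (fun x : ℝ => (Φ t x - P t 0 - P t 1 * x) / x / x)
          MeasureTheory.volume 0 1) ∧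
    (fun t : ℝ => b * ∫ x in (0:ℝ)..1, (Φ t x - P t 0 - P t 1 * x) / x / x)
      =O[Filter.atTop] fun t : ℝ => Real.log t / t ^ 2 := by

  have hPhiMem : ∀ x ∈ Set.Icc (0:ℝ) 1, ∀ t : ℝ, 0 ≤ t → Φ t x ∈ Set.Icc (0:ℝ) 1 := by
    intro x hx t ht
    constructor
    · exact (hΦ t ht x hx).nonneg fun j => mul_nonneg (hPnn t ht j) (pow_nonneg hx.1 j)
    · refine hasSum_le (fun j => ?_) (hΦ t ht x hx) (hPsum t ht)
      exact mul_le_of_le_one_right (hPnn t ht j) (pow_le_one₀ hx.1 hx.2)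
  have hP0 : ∀ t : ℝ, 0 ≤ t → Φ t 0 = P t 0 := by
    intro t ht
    refine (hΦ t ht 0 (by simp)).unique ?_
    have := hasSum_single (f := fun j : ℕ => P t j * (0:ℝ) ^ j) 0 (by
      intro j hj; simp [hj])
    simpa using this
  have hFs : ∀ t : ℝ, 0 ≤ t → ∀ x ∈ Set.Ioc (0:ℝ) 1,
      HasSum (fun j : ℕ => P t (j + 2) * x ^ j) ((Φ t x - P t 0 - P t 1 * x) / x / x) :=
    fun t ht x hx => aux_F (P t) _ x hx.1 (hΦ t ht x ⟨hx.1.le, hx.2⟩)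
  have hPs2 : ∀ t : ℝ, 0 ≤ t → HasSum (fun j : ℕ => P t (j + 2)) (1 - P t 0 - P t 1) := by
    intro t ht
    have := aux_F (P t) 1 1 one_pos (by simpa using hPsum t ht)
    simpa using this
  have hGs : ∀ t : ℝ, 0 ≤ t → ∀ x ∈ Set.Icc (0:ℝ) 1,
      Summable (fun j : ℕ => P t (j + 2) * x ^ j) := by
    intro t ht x hx
    refine Summable.of_nonneg_of_le (fun j => mul_nonneg (hPnn t ht _) (pow_nonneg hx.1 j))
      (fun j => ?_) (hPs2 t ht).summable
    exact mul_le_of_le_one_right (hPnn t ht _) (pow_le_one₀ hx.1 hx.2)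
  have hInt : ∀ t : ℝ, 0 ≤ t →
        IntervalIntegrable (fun x : ℝ => (Φ t x - P t 0 - P t 1 * x) / x / x)
          MeasureTheory.volume 0 1 := by
    intro t ht
    have hmono : MonotoneOn (fun x : ℝ => ∑' j : ℕ, P t (j + 2) * x ^ j) (Set.uIcc 0 1) := by
      rw [Set.uIcc_of_le zero_le_one]
      intro x hx y hy hxy
      refine (hGs t ht x hx).tsum_le_tsum (fun j => ?_) (hGs t ht y hy)
      exact mul_le_mul_of_nonneg_left (pow_le_pow_left₀ hx.1 hxy j) (hPnn t ht _)
    refine hmono.intervalIntegrable.congr ?_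
    intro x hx
    rw [Set.uIoc_of_le zero_le_one] at hx
    exact (hFs t ht x hx).tsum_eq
  refine ⟨fun t ht => hInt t ht.le, ?_⟩
  have hb0 : 0 ≤ b := by
    refine hb.nonneg fun k => ?_
    match k with
    | 0 => simp
    | 1 => simp
    | k + 2 =>
      have := ha (k + 2) (by omega)
      have hk : (0:ℝ) ≤ k := Nat.cast_nonneg k
      apply mul_nonneg (mul_nonneg (Nat.cast_nonneg _) _) this
      push_cast; linarith
  set c := -(a 1) - a 0 with hc
  have hcp : 0 < c := by linarith
  obtain ⟨K, hK⟩ := aux_lip a f hf hcrit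
  have hfb := aux_f a f ha ha1 hf b hcrit hb
  set M := b / c ^ 3 with hM
  have hM0 : 0 ≤ M := by positivity
  have h00 : (0:ℝ) ∈ Set.Icc (0:ℝ) 1 := by simp
  have hinc : ∀ t : ℝ, 0 < t → ∀ x : ℝ, 0 ≤ x → x < 1 →
      (Φ t x - P t 0) * (1 - x) ≤ M / t ^ 2 := by
    intro t ht x hx0 hx1
    have hx : x ∈ Set.Icc (0:ℝ) 1 := ⟨hx0, hx1.le⟩
    rw [← hP0 t ht.le]
    exact aux_inc f (fun s => Φ s x) (fun s => Φ s 0) b c x hb0 hcp K hK hfb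
      (hPhiMem 0 h00) (hΦ0 0 h00) (hKol 0 h00) hx0 hx1 (hPhiMem x hx) (hΦ0 x hx) (hKol x hx) t ht
  refine Asymptotics.IsBigO.of_bound (b * ((8 * M + 1) * 3)) ?_
  filter_upwards [Filter.eventually_ge_atTop (2:ℝ)] with t ht
  have ht0 : 0 < t := by linarith
  have hlt : 0 ≤ Real.log t / t ^ 2 := div_nonneg (Real.log_nonneg (by linarith)) (by positivity)
  rw [Real.norm_eq_abs, Real.norm_eq_abs, abs_of_nonneg hlt, abs_mul, abs_of_nonneg hb0, mul_assoc]
  refine mul_le_mul_of_nonneg_left ?_ hb0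
  -- crude bound away from zero
  have hlow : ∀ x : ℝ, 1 / 2 ≤ x → x < 1 →
      (Φ t x - P t 0 - P t 1 * x) / x / x * (1 - x) ≤ 4 * (M / t ^ 2) := by
    intro x hx hx1
    have hx0 : 0 < x := by linarith
    have h := hinc t ht0 x hx0.le hx1
    have hp1 := hPnn t ht0.le 1
    have e : (Φ t x - P t 0 - P t 1 * x) / x / x * (1 - x) =
        ((Φ t x - P t 0) * (1 - x) - P t 1 * x * (1 - x)) / x ^ 2 := by
      field_simp
    rw [e, div_le_iff₀ (by positivity)]
    have h1 : 0 ≤ P t 1 * x * (1 - x) := mul_nonneg (mul_nonneg hp1 hx0.le) (by linarith)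
    have h2 : 0 ≤ M / t ^ 2 := by positivity
    have h3 : 1 ≤ 4 * x ^ 2 := by nlinarith
    nlinarith
  refine aux_int _ (8 * M) t (by positivity) ht (hInt t ht0.le) ?_ ?_ ?_
  · intro x hx
    exact (hFs t ht0.le x ⟨hx.1, hx.2.le⟩).nonneg
      fun j => mul_nonneg (hPnn t ht0.le _) (pow_nonneg hx.1.le j)
  · intro x hx
    have h := hasSum_le (fun j => mul_le_of_le_one_right (hPnn t ht0.le (j + 2))
      (pow_le_one₀ hx.1.le hx.2.le)) (hFs t ht0.le x ⟨hx.1, hx.2.le⟩) (hPs2 t ht0.le)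
    linarith [hPnn t ht0.le 0, hPnn t ht0.le 1]
  · intro x hx
    have h2 : 0 ≤ M / t ^ 2 := by positivity
    have e8 : 8 * M / t ^ 2 = 8 * (M / t ^ 2) := by ring
    rw [e8]
    rcases le_total (1 / 2) x with h | h
    · linarith [hlow x h hx.2]
    · have hm := hasSum_le (fun j => mul_le_mul_of_nonneg_left
        (pow_le_pow_left₀ hx.1.le h j) (hPnn t ht0.le (j + 2)))
        (hFs t ht0.le x ⟨hx.1, hx.2.le⟩) (hFs t ht0.le (1 / 2) ⟨by norm_num, by norm_num⟩)
      have hl := hlow (1 / 2) le_rfl (by norm_num)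
      have hF0 : 0 ≤ (Φ t x - P t 0 - P t 1 * x) / x / x :=
        (hFs t ht0.le x ⟨hx.1, hx.2.le⟩).nonneg
          fun j => mul_nonneg (hPnn t ht0.le _) (pow_nonneg hx.1.le j)
      have h5 : (Φ t x - P t 0 - P t 1 * x) / x / x * (1 - x) ≤
          (Φ t x - P t 0 - P t 1 * x) / x / x :=
        mul_le_of_le_one_right hF0 (by linarith [hx.1])
      linarith
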